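/- arXiv:0802.1591 — 2 statements merged into one kernel-verified Lean document; each statement's English description precedes it below -/
import Mathlib

section
/- Let L be a subalgebra of a Lie algebra Q over a ring with 1/2, 1/3 invertible, such that Q is a weak algebra of quotients of L (i.e., for every nonzero q ∈ Q, [L,q] is nonzero and contained in L). If L is strongly non-degenerate, then Q is strongly non-degenerate. -/
/-- Ring-level computation: the cubic vanishing `A C B A B B A = 0` polarised. -/
theorem aux_square {E : Type*} [Ring E] (A B D : E) (hA : A * A = 0)
    (hB : A * (B * A) = 0) (hD : A * (D * A) = 0)
    (hsymm : A * (D * (B * A)) = A * (B * (D * A)))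
    (h1 : A * (B * (D * (A * (B * (B * A))))) = 0)
    (h2 : A * (B * (B * (A * (B * (D * A))))) = 0)
    (h3 : A * (B * (B * (A * (D * (D * A))))) =
      -(A * (B * (D * (A * (B * (D * A))))) + A * (B * (D * (A * (B * (D * A))))))) :
    ⁅A, ⁅B, ⁅B, ⁅A, D⁆⁆⁆⁆ * ⁅A, ⁅B, ⁅B, ⁅A, D⁆⁆⁆⁆ = 0 := by
  have hA' : ∀ x, A * (A * x) = 0 := fun x => by rw [← mul_assoc, hA, zero_mul]
  have hB' : ∀ x, A * (B * (A * x)) = 0 := fun x => by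
    have := congrArg (· * x) hB; simpa [mul_assoc] using this
  have hD' : ∀ x, A * (D * (A * x)) = 0 := fun x => by
    have := congrArg (· * x) hD; simpa [mul_assoc] using this
  have hs' : ∀ x, A * (D * (B * (A * x))) = A * (B * (D * (A * x))) := fun x => by
    have := congrArg (· * x) hsymm; simpa [mul_assoc] using this
  have h1' : ∀ x, A * (B * (D * (A * (B * (B * (A * x)))))) = 0 := fun x => by
    have := congrArg (· * x) h1; simpa [mul_assoc] using this
  have h2' : ∀ x, A * (B * (B * (A * (B * (D * (A * x)))))) = 0 := fun x => by
    have := congrArg (· * x) h2; simpa [mul_assoc] using this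
  have h3' : ∀ x, A * (B * (B * (A * (D * (D * (A * x)))))) =
      -(A * (B * (D * (A * (B * (D * (A * x)))))) + A * (B * (D * (A * (B * (D * (A * x))))))) :=
    fun x => by
      have := congrArg (· * x) h3; simpa [mul_assoc, add_mul] using this
  have e : ⁅A, ⁅B, ⁅B, ⁅A, D⁆⁆⁆⁆ = A * (B * (B * (A * D))) - A * (B * (B * (D * A)))
      + (A * (B * (D * (A * B))) + A * (B * (D * (A * B))))
      + (B * (A * (B * (D * A))) + B * (A * (B * (D * A))))
      - A * (D * (B * (B * A))) + D * (A * (B * (B * A))) := by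
    simp only [Ring.lie_def, mul_sub, sub_mul, mul_assoc, hA, hB, hD, hA', hB', hD', hsymm, hs',
      mul_zero, zero_mul]
    abel
  rw [e]
  simp only [mul_add, add_mul, mul_sub, sub_mul, mul_assoc, hA, hB, hD, hA', hB', hD', hsymm, hs',
    h1, h2, h1', h2', h3, h3', mul_zero, mul_neg, add_zero, sub_zero, neg_zero, zero_add, sub_self]

/-- if `Q` is a weak algebra of quotients of a strongly non-degenerate
subalgebra `L`, then `Q` is strongly non-degenerate. -/
theorem stmt_4 {R Q : Type*} [CommRing R] [Invertible (2 : R)] [Invertible (3 : R)]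
    [LieRing Q] [LieAlgebra R Q] (L : LieSubalgebra R Q)
    (hweak : ∀ q : Q, q ≠ 0 → (∃ l ∈ L, ⁅l, q⁆ ≠ 0) ∧ ∀ l ∈ L, ⁅l, q⁆ ∈ L)
    (hL : ∀ x ∈ L, (∀ y ∈ L, ⁅x, ⁅x, y⁆⁆ = 0) → x = 0) :
    ∀ q : Q, (∀ p : Q, ⁅q, ⁅q, p⁆⁆ = 0) → q = 0 := by
  intro q hq
  have hideal : ∀ p : Q, ∀ l ∈ L, ⁅p, l⁆ ∈ L := by
    intro p l hl
    by_cases hp : p = 0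
    · simp [hp]
    · rw [← lie_skew]; exact L.neg_mem ((hweak p hp).2 l hl)
  have t2 : ∀ T : Module.End R Q, T + T = 0 → T = 0 := fun T h => by
    have h' : (2 : R) • T = 0 := by rw [two_smul, h]
    simpa using congrArg (fun x => (⅟2 : R) • x) h'
  have t3 : ∀ T : Module.End R Q, T + T + T = 0 → T = 0 := fun T h => by
    have h' : (3 : R) • T = 0 := by
      rw [show (3 : R) = 1 + 1 + 1 by norm_num, add_smul, add_smul, one_smul, h]
    simpa using congrArg (fun x => (⅟3 : R) • x) h'
  letI : LieRing (Module.End R Q) := LieRing.ofAssociativeRing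
  let ad : Q →ₗ⁅R⁆ Module.End R Q := LieAlgebra.ad R Q
  have had : ∀ x y, ad x y = ⁅x, y⁆ := fun x y => rfl
  obtain ⟨A, hAdef⟩ : ∃ A, A = ad q := ⟨_, rfl⟩
  have hA : A * A = 0 := by
    ext p; rw [hAdef]; exact hq p
  have hA' : ∀ x, A * (A * x) = 0 := fun x => by rw [← mul_assoc, hA, zero_mul]
  have hV : ∀ v, A * (ad v * A) = 0 := by
    intro v
    have h : ⁅A, ⁅A, ad v⁆⁆ = 0 := by
      rw [hAdef, ← LieHom.map_lie, ← LieHom.map_lie, hq, map_zero]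
    simp only [Ring.lie_def, mul_sub, sub_mul, mul_assoc, hA, hA', mul_zero] at h
    apply t2
    rw [← neg_eq_zero, ← h]; abel
  have hV' : ∀ v x, A * (ad v * (A * x)) = 0 := fun v x => by
    have := congrArg (· * x) (hV v); simpa [mul_assoc] using this
  have hsymm : ∀ b d, A * (ad d * (ad b * A)) = A * (ad b * (ad d * A)) := by
    intro b d
    have h := hV ⁅d, b⁆
    rw [LieHom.map_lie] at h
    simp only [Ring.lie_def, mul_sub, sub_mul, mul_assoc] at h
    exact sub_eq_zero.1 h
  -- step 2
  have s2 : ∀ b, A * (ad b * (ad b * (A * (ad b * (ad b * A))))) = 0 := by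
    intro b
    have h := hV ⁅b, ⁅b, ⁅b, ⁅q, b⁆⁆⁆⁆
    simp only [LieHom.map_lie, ← hAdef] at h
    simp only [Ring.lie_def, mul_sub, sub_mul, mul_assoc, hA, hA', hV, hV', mul_zero] at h
    apply t2; apply t3
    rw [← neg_eq_zero, ← h]; abel
  have key : ∀ b ∈ L, ∀ d ∈ L, ⁅ad q, ⁅ad b, ⁅ad b, ⁅ad q, ad d⁆⁆⁆⁆ *
      ⁅ad q, ⁅ad b, ⁅ad b, ⁅ad q, ad d⁆⁆⁆⁆ = 0 → ⁅q, ⁅b, ⁅b, ⁅q, d⁆⁆⁆⁆ = 0 := by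
    intro b hb d hd h
    apply hL
    · exact hideal _ _ (hideal _ _ (hideal _ _ (hideal _ _ hd)))
    · intro y _
      simp only [← LieHom.map_lie] at h
      exact LinearMap.congr_fun h y
  -- step 3
  have s3 : ∀ c, ∀ b ∈ L, A * (ad c * (ad b * (A * (ad b * (ad b * A))))) = 0 := by
    intro c b hb
    have z := key b hb b hb (by
      rw [← hAdef]
      exact aux_square A (ad b) (ad b) hA (hV b) (hV b) rfl (s2 b) (s2 b) (by simp [s2 b]))
    have h : A * (ad c * ad ⁅q, ⁅b, ⁅b, ⁅q, b⁆⁆⁆⁆) = 0 := by rw [z]; simp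
    simp only [LieHom.map_lie, ← hAdef] at h
    simp only [Ring.lie_def, mul_sub, sub_mul, mul_assoc, hA, hA', hV, hV', mul_zero] at h
    apply t3
    first
      | (rw [← h]; abel)
      | (rw [← neg_eq_zero, ← h]; abel)
  -- polarisation
  have s4 : ∀ c, ∀ b ∈ L, ∀ d ∈ L,
      A * (ad c * (ad d * (A * (ad b * (ad b * A))))) +
      (A * (ad c * (ad b * (A * (ad b * (ad d * A))))) +
       A * (ad c * (ad b * (A * (ad b * (ad d * A)))))) = 0 := by
    intro c b hb d hd
    have h1 := s3 c (b + d) (L.add_mem hb hd)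
    have h2 := s3 c (b - d) (L.sub_mem hb hd)
    have h3 := s3 c d hd
    simp only [map_add, map_sub, mul_add, add_mul, mul_sub, sub_mul, hsymm b d] at h1 h2
    apply t2
    have h4 := congrArg₂ (· - ·) h1 (congrArg₂ (· + ·) h2 (congrArg₂ (· + ·) h3 h3))
    simp only [add_zero, sub_zero] at h4
    rw [← h4]; abel
  have s5 : ∀ b ∈ L, ∀ d ∈ L, ⁅q, ⁅b, ⁅b, ⁅q, d⁆⁆⁆⁆ = 0 := by
    intro b hb d hd
    have e1 : A * (ad b * (ad d * (A * (ad b * (ad b * A))))) = 0 := by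
      have h := s3 d b hb
      have hs := congrArg (· * (ad b * (ad b * A))) (hsymm b d)
      simp only [mul_assoc] at hs
      rw [← hs, h]
    apply key b hb d hd
    rw [← hAdef]
    refine aux_square A (ad b) (ad d) hA (hV b) (hV d) (hsymm b d) e1 ?_ ?_
    · have h := s4 b b hb d hd
      rw [e1, zero_add] at h
      exact t2 _ h
    · have h := s4 b d hd b hb
      rw [hsymm b d] at h
      exact eq_neg_of_add_eq_zero_left h
  have s6 : ∀ l ∈ L, ⁅q, l⁆ = 0 := by
    intro l hl
    apply hL _ (hideal _ _ hl)
    intro y hy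
    have h : ad ⁅q, l⁆ * ad ⁅q, l⁆ = -(A * (ad l * (ad l * A))) := by
      simp only [LieHom.map_lie, ← hAdef]
      simp only [Ring.lie_def, mul_sub, sub_mul, mul_assoc, hA, hA', hV, hV', mul_zero]
      abel
    have h' := LinearMap.congr_fun h y
    rw [hAdef] at h'
    have h5 := s5 l hl y hy
    change ⁅⁅q, l⁆, ⁅⁅q, l⁆, y⁆⁆ = -⁅q, ⁅l, ⁅l, ⁅q, y⁆⁆⁆⁆ at h'
    rw [h', h5, neg_zero]
  by_contra hne
  obtain ⟨l, hl, hlq⟩ := (hweak q hne).1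
  apply hlq
  rw [← lie_skew, s6 l hl, neg_zero]
end

section
/- Let I be an ideal of a Lie algebra L over a ring with 1/2, 1/3 invertible, and suppose I is strongly non-degenerate (as a Lie algebra). Then QAnn_L(I) = Ann_L(I), i.e., every a ∈ L with [a,[a,I]] = 0 satisfies [a,I] = 0. -/
/-- Words `A = DXX`, `B = DXZ`, `C = DZZ`; formal consequences of the quadratic and
cubic relations. -/
theorem aux_words {E : Type*} [Ring E] (D X Z A B C : E)
    (hA : A = D * (X * X)) (hB : B = D * (X * Z)) (hC : C = D * (Z * Z))
    (hAA : A * A * D = 0) (hAB : A * B * D = - (B * A * D)) (hBC : B * C * D = -(C * B * D))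
    (hAC : A * C * D = - (C * A * D) - 4 * (B * B * D))
    (hABC : A * B * C * D = C * B * A * D) :
    B * A * C * A * D = 0 ∧ A * C * A * B * D = 0 ∧ A * C * A * C * A * D = 0 := by
  have eAA : ∀ s, A * (A * (D * s)) = 0 := fun s => by
    have := congrArg (· * s) hAA; simpa [mul_assoc] using this
  have eAB : ∀ s, A * (B * (D * s)) = -(B * (A * (D * s))) := fun s => by
    have := congrArg (· * s) hAB; simpa [mul_assoc] using this
  have eBC : ∀ s, B * (C * (D * s)) = -(C * (B * (D * s))) := fun s => by
    have := congrArg (· * s) hBC; simpa [mul_assoc] using this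
  have eAC : ∀ s, A * (C * (D * s)) = -(C * (A * (D * s))) - 4 * (B * (B * (D * s))) := fun s => by
    have := congrArg (· * s) hAC; simpa [mul_assoc, sub_mul] using this
  have eABC : ∀ s, A * (B * (C * (D * s))) = C * (B * (A * (D * s))) := fun s => by
    have := congrArg (· * s) hABC; simpa [mul_assoc] using this
  have pA : ∀ s, A * s = D * (X * X * s) := fun s => by rw [hA]; simp [mul_assoc]
  have pB : ∀ s, B * s = D * (X * Z * s) := fun s => by rw [hB]; simp [mul_assoc]
  have pC : ∀ s, C * s = D * (Z * Z * s) := fun s => by rw [hC]; simp [mul_assoc]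
  have h1 : B * (A * (C * (A * D))) = 0 := by
    have e1 := eABC (X * X * D)
    have e2 := eAB (Z * Z * (A * D))
    have e3 := eAA D
    rw [← pA, ] at e1
    rw [← pC] at e2
    rw [e2] at e1
    have e4 : A * (A * D) = 0 := by rw [← mul_assoc, hAA]
    rw [e4] at e1
    simpa using e1
  have h2 : A * (C * (A * (B * D))) = 0 := by
    have e1 : A * (B * (C * D)) = C * (B * (A * D)) := by simpa [mul_assoc] using hABC
    have e2 : A * (A * (B * (C * D))) = 0 := by rw [pB, eAA]
    have e3 : A * (B * D) = -(B * (A * D)) := by simpa [mul_assoc] using hAB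
    rw [e1] at e2
    rw [e3]; simp [e2]
  refine ⟨by simpa [mul_assoc] using h1, by simpa [mul_assoc] using h2, ?_⟩
  have e1 : A * (C * (A * D)) = -(4 * (B * (B * (A * D)))) := by
    have := eAC (X * X * D)
    rw [← pA] at this
    have e4 : A * (A * D) = 0 := by rw [← mul_assoc, hAA]
    rw [this, e4]; simp
  have e2 : C * (B * (B * (A * D))) = B * (B * (C * (A * D))) := by
    rw [pA D, eBC, pB (D * _), mul_neg, eBC, ]
    simp
  have e3 : A * (B * (B * (C * (A * D)))) = 0 := by
    have f1 := eAB (X * Z * (C * (A * D)))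
    rw [← pB] at f1
    have f2 := eAB (Z * Z * (A * D))
    rw [← pC] at f2
    rw [f1, f2, mul_neg, h1]; simp
  have e4 : ∀ s t : E, s * (4 * t) = 4 * (s * t) := fun s t => by
    rw [← mul_assoc, ← mul_assoc]; congr 1
    exact (Nat.cast_commute 4 s).symm.eq
  calc A * C * A * C * A * D = A * (C * (A * (C * (A * D)))) := by simp [mul_assoc]
    _ = 0 := by rw [e1, mul_neg, mul_neg, e4, e4, e2, e3]; simp

/-- The Jordan identity `(ad (P²m))² = P² M² P²` for `P³ = 0`. -/
theorem aux_jordan {E : Type*} [Ring E] (h3 : ∀ t : E, 3 * t = 0 → t = 0) (P M : E)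
    (hP : P * P * P = 0) (hPM : (⁅P, ⁅P, ⁅P, M⁆⁆⁆ : E) = 0) :
    P * (P * (M * P)) = P * (M * (P * P)) ∧
    (⁅P, ⁅P, M⁆⁆ : E) * ⁅P, ⁅P, M⁆⁆ = P * (P * (M * (M * (P * P)))) := by
  have hP' : P * (P * P) = 0 := by rw [← mul_assoc, hP]
  have hPt : ∀ t, P * (P * (P * t)) = 0 := fun t => by
    rw [← mul_assoc, ← mul_assoc, hP, zero_mul]
  have h : P * (P * (M * P)) = P * (M * (P * P)) := by
    have : 3 * (P * (M * (P * P)) - P * (P * (M * P))) = 0 := by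
      rw [← hPM]
      simp only [Ring.lie_def, mul_sub, sub_mul, mul_assoc, hP', hPt, mul_zero]
      noncomm_ring
    exact (sub_eq_zero.mp (h3 _ this)).symm
  have ht : ∀ t, P * (P * (M * (P * t))) = P * (M * (P * (P * t))) := fun t => by
    have := congrArg (· * t) h; simpa [mul_assoc] using this
  refine ⟨h, ?_⟩
  simp only [Ring.lie_def, mul_sub, sub_mul, mul_assoc, hP', hPt, h, ht, mul_zero]
  abel

theorem aux_ring {E : Type*} [Ring E] (h2 : ∀ t : E, 2 * t = 0 → t = 0)
    (h3 : ∀ t : E, 3 * t = 0 → t = 0) (D X Z : E)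
    (hDD : D * D = 0) (hDX : D * X * D = 0) (hDZ : D * Z * D = 0)
    (hXZ : D * ⁅X, Z⁆ * D = 0)
    (hxxxx : D * ⁅X, ⁅X, ⁅X, ⁅X, D⁆⁆⁆⁆ * D = 0)
    (hxxxz : D * ⁅X, ⁅X, ⁅X, ⁅Z, D⁆⁆⁆⁆ * D = 0)
    (hzzzx : D * ⁅Z, ⁅Z, ⁅Z, ⁅X, D⁆⁆⁆⁆ * D = 0)
    (hxxzz : D * ⁅X, ⁅X, ⁅Z, ⁅Z, D⁆⁆⁆⁆ * D = 0)
    (hcub : D * ⁅⁅X, ⁅X, ⁅X, D⁆⁆⁆, ⁅Z, ⁅Z, ⁅Z, D⁆⁆⁆⁆ * D = 0)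
    (hZ : (⁅⁅D, X⁆, ⁅⁅D, X⁆, ⁅⁅D, X⁆, Z⁆⁆⁆ : E) = 0)
    (hM : (⁅⁅D, X⁆, ⁅⁅D, X⁆, ⁅⁅D, X⁆, ⁅Z, ⁅⁅D, X⁆, Z⁆⁆⁆⁆⁆ : E) = 0) :
    (⁅⁅D, X⁆, ⁅⁅D, X⁆, ⁅Z, ⁅⁅D, X⁆, Z⁆⁆⁆⁆ : E) *
      ⁅⁅D, X⁆, ⁅⁅D, X⁆, ⁅Z, ⁅⁅D, X⁆, Z⁆⁆⁆⁆ = 0 := by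
  have dd : ∀ t, D * (D * t) = 0 := fun t => by rw [← mul_assoc, hDD, zero_mul]
  have dx0 : D * (X * D) = 0 := by rw [← mul_assoc, hDX]
  have dz0 : D * (Z * D) = 0 := by rw [← mul_assoc, hDZ]
  have dx : ∀ t, D * (X * (D * t)) = 0 := fun t => by
    rw [← mul_assoc, ← mul_assoc, hDX, zero_mul]
  have dz : ∀ t, D * (Z * (D * t)) = 0 := fun t => by
    rw [← mul_assoc, ← mul_assoc, hDZ, zero_mul]
  have zx0 : D * (Z * (X * D)) = D * (X * (Z * D)) := by
    simp only [Ring.lie_def, mul_sub, sub_mul, mul_assoc] at hXZ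
    exact (sub_eq_zero.mp hXZ).symm
  have zx : ∀ t, D * (Z * (X * (D * t))) = D * (X * (Z * (D * t))) := fun t => by
    have := congrArg (· * t) zx0; simpa [mul_assoc] using this
  simp only [Ring.lie_def, mul_sub, sub_mul, mul_assoc, hDD, dd, dx0, dz0, dx, dz, zx0, zx,
    mul_zero] at hxxxx hxxxz hzzzx hxxzz hcub
  have hw := aux_words D X Z _ _ _ rfl rfl rfl
    (by
      simp only [mul_assoc]
      refine h2 _ (h3 _ ?_)
      rw [← hxxxx]; noncomm_ring)
    (by
      simp only [mul_assoc]
      refine eq_neg_of_add_eq_zero_left (h3 _ ?_)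
      rw [← hxxxz]; noncomm_ring)
    (by
      simp only [mul_assoc]
      refine eq_neg_of_add_eq_zero_left (h3 _ ?_)
      rw [← hzzzx]; noncomm_ring)
    (by
      simp only [mul_assoc]
      rw [← sub_eq_zero]
      rw [← hxxzz]; noncomm_ring)
    (by
      simp only [mul_assoc, zx, zx0]
      rw [← sub_eq_zero]
      refine h3 _ (h3 _ ?_)
      rw [← neg_eq_zero, ← hcub]; noncomm_ring)
  obtain ⟨w1, w2, w3⟩ := hw
  simp only [mul_assoc] at w1 w2 w3
  obtain ⟨P, hPdef⟩ : ∃ P, P = ⁅D, X⁆ := ⟨_, rfl⟩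
  rw [← hPdef] at hZ hM ⊢
  rw [Ring.lie_def] at hPdef
  have PP : P * P = -(D * (X * (X * D))) := by
    rw [hPdef]
    simp only [mul_sub, sub_mul, mul_assoc, hDD, dd, dx0, dx, mul_zero]
    noncomm_ring
  have PPP : P * P * P = 0 := by
    rw [PP, hPdef]
    simp only [mul_sub, neg_mul, mul_assoc, hDD, dd, dx0, dx, mul_zero]
    simp
  obtain ⟨K, hK⟩ : ∃ K, K = P * (P * (Z * (Z * (P * P)))) := ⟨_, rfl⟩
  have hK' : K = D * (X * (X * (D * (Z * (Z * (D * (X * (X * D)))))))) := by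
    rw [hK, ← mul_assoc, PP]; simp [mul_assoc]
  have k1 : P * (Z * K) = 0 := by
    rw [hK', hPdef, ← w1]
    simp only [sub_mul, mul_assoc, dz, mul_zero, sub_zero]
  have k2 : K * (Z * P) = 0 := by
    rw [hK', hPdef, ← neg_eq_zero, ← w2]
    simp only [mul_sub, mul_assoc, dz, mul_zero, zx0]
    simp
  have k3 : K * (Z * (Z * (P * P))) = 0 := by
    rw [hK', PP, ← neg_eq_zero, ← w3]
    simp [mul_assoc]
  obtain ⟨n0, -⟩ := aux_jordan h3 P Z PPP hZ
  have n : ∀ t, P * (P * (Z * (P * t))) = P * (Z * (P * (P * t))) := fun t => by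
    have := congrArg (· * t) n0; simpa [mul_assoc] using this
  rw [(aux_jordan h3 P _ PPP hM).2]
  have hPt : ∀ t, P * (P * (P * t)) = 0 := fun t => by
    rw [← mul_assoc, ← mul_assoc, PPP, zero_mul]
  have hP0 : P * (P * P) = 0 := by rw [← mul_assoc, PPP]
  have t1 : P * (P * (Z * (P * (Z * (Z * (P * (Z * (P * P)))))))) = 0 := by
    rw [n, ← n0]
    calc _ = P * (Z * (P * (P * (Z * (Z * (P * P)))))) * (Z * P) := by simp only [mul_assoc]
      _ = 0 := by rw [← hK, k1, zero_mul]
  have t2 : P * (P * (Z * (P * (Z * (P * (Z * (Z * (P * P)))))))) = 0 := by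
    rw [n, n, ← hK, k1]; simp
  have t3 : P * (P * (Z * (Z * (P * (Z * (P * (Z * (P * P)))))))) = 0 := by
    rw [← n0, ← n]
    calc _ = P * (P * (Z * (Z * (P * P)))) * (Z * P) * (Z * P) := by simp only [mul_assoc]
      _ = 0 := by rw [← hK, k2, zero_mul]
  have t4 : P * (P * (Z * (Z * (P * (P * (Z * (Z * (P * P)))))))) = 0 := by
    calc _ = P * (P * (Z * (Z * (P * P)))) * (Z * (Z * (P * P))) := by simp only [mul_assoc]
      _ = 0 := by rw [← hK, k3]
  simp only [Ring.lie_def, mul_sub, sub_mul, mul_assoc, hPt, hP0, t1, t2, t3, t4, mul_zero]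
  simp

/-- if `I` is a strongly non-degenerate ideal of `L`, then the quadratic
annihilator of `I` in `L` equals the annihilator of `I` in `L`. -/
theorem stmt_6 {R L : Type*} [CommRing R] [Invertible (2 : R)] [Invertible (3 : R)]
    [LieRing L] [LieAlgebra R L] (I : LieIdeal R L)
    (hI : ∀ y ∈ I, (∀ z ∈ I, ⁅y, ⁅y, z⁆⁆ = 0) → y = 0) :
    ∀ a : L, (∀ b ∈ I, ⁅a, ⁅a, b⁆⁆ = 0) → ∀ b ∈ I, ⁅a, b⁆ = 0 := by
  intro a ha
  have h2 : ∀ t : Module.End R I, 2 * t = 0 → t = 0 := fun t ht => by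
    have : (2 : R) • t = 0 := by rw [← ht, two_smul, two_mul]
    simpa using congrArg (fun s => (⅟2 : R) • s) this
  have h3 : ∀ t : Module.End R I, 3 * t = 0 → t = 0 := fun t ht => by
    have : (3 : R) • t = 0 := by
      rw [← ht]; ext v; simp [ofNat_smul_eq_nsmul]
    simpa using congrArg (fun s => (⅟3 : R) • s) this
  let _ : LieRing (Module.End R I) := LieRing.ofAssociativeRing
  obtain ⟨φ, hφ⟩ : ∃ φ : L →ₗ⁅R⁆ Module.End R I, φ = LieModule.toEnd R L I := ⟨_, rfl⟩
  have hφa : ∀ u (v : I), ((φ u v : I) : L) = ⁅u, (v : L)⁆ := fun u v => by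
    subst hφ; simp
  have nd : ∀ y ∈ I, φ y * φ y = 0 → y = 0 := fun y hy h => by
    refine hI y hy fun z hz => ?_
    have := congrArg (fun f : Module.End R I => ((f ⟨z, hz⟩ : I) : L)) h
    simpa [hφa] using this
  have hDD : φ a * φ a = 0 := by
    ext v; simp [hφa, ha v v.2]
  have hD : ∀ m ∈ I, φ a * φ m * φ a = 0 := fun m hm => by
    have h := congrArg φ (ha m hm)
    simp only [LieHom.map_lie, map_zero, Ring.lie_def, mul_sub, sub_mul] at h
    have e1 : φ a * (φ a * φ m) = 0 := by rw [← mul_assoc, hDD, zero_mul]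
    have e2 : φ m * φ a * φ a = 0 := by rw [mul_assoc, hDD, mul_zero]
    rw [e1, e2] at h
    refine h2 _ ?_
    rw [← neg_eq_zero, ← h]; noncomm_ring
  have memr : ∀ u v : L, v ∈ I → ⁅u, v⁆ ∈ I := fun u v hv => lie_mem_right R L I u v hv
  have meml : ∀ u v : L, u ∈ I → ⁅u, v⁆ ∈ I := fun u v hu => lie_mem_left R L I u v hu
  intro x hx
  have hpI : ⁅a, x⁆ ∈ I := memr _ _ hx
  -- `P³ = 0`
  have dx0 := hD x hx
  have PPP : φ ⁅a, x⁆ * φ ⁅a, x⁆ * φ ⁅a, x⁆ = 0 := by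
    have dd : ∀ t, φ a * (φ a * t) = 0 := fun t => by rw [← mul_assoc, hDD, zero_mul]
    have dx : ∀ t, φ a * (φ x * (φ a * t)) = 0 := fun t => by
      rw [← mul_assoc, ← mul_assoc, dx0, zero_mul]
    rw [mul_assoc] at dx0
    simp only [LieHom.map_lie, Ring.lie_def, mul_sub, sub_mul, mul_assoc, hDD, dd, dx0, dx,
      mul_zero]
    simp
  have hcube : ∀ m ∈ I, ⁅⁅a, x⁆, ⁅⁅a, x⁆, ⁅⁅a, x⁆, m⁆⁆⁆ = 0 := fun m hm => by
    have := congrArg (fun f : Module.End R I => ((f ⟨m, hm⟩ : I) : L)) PPP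
    simpa only [Module.End.mul_apply, hφa, LinearMap.zero_apply, ZeroMemClass.coe_zero] using this
  -- first family of absolute zero divisors
  have s1 : ∀ z ∈ I, ⁅⁅a, x⁆, ⁅⁅a, x⁆, ⁅z, ⁅⁅a, x⁆, z⁆⁆⁆⁆ = 0 := fun z hz => by
    refine nd _ (memr _ _ (memr _ _ (meml _ _ hz))) ?_
    have hxa : ⁅x, a⁆ ∈ I := meml _ _ hx
    have hza : ⁅z, a⁆ ∈ I := meml _ _ hz
    have := aux_ring h2 h3 (φ a) (φ x) (φ z) hDD (hD x hx) (hD z hz)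
      (by simpa only [LieHom.map_lie] using hD _ (memr x z hz))
      (by simpa only [LieHom.map_lie] using hD _ (memr x _ (memr x _ (memr x _ hxa))))
      (by simpa only [LieHom.map_lie] using hD _ (memr x _ (memr x _ (memr x _ hza))))
      (by simpa only [LieHom.map_lie] using hD _ (memr z _ (memr z _ (memr z _ hxa))))
      (by simpa only [LieHom.map_lie] using hD _ (memr x _ (memr x _ (memr z _ hza))))
      (by simpa only [LieHom.map_lie] using
        hD _ (meml _ ⁅z, ⁅z, ⁅z, a⁆⁆⁆ (memr x _ (memr x _ hxa))))
      (by simpa only [LieHom.map_lie, map_zero] using congrArg φ (hcube z hz))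
      (by simpa only [LieHom.map_lie, map_zero] using
        congrArg φ (hcube ⁅z, ⁅⁅a, x⁆, z⁆⁆ (meml _ _ hz)))
    simpa only [LieHom.map_lie] using this
  obtain ⟨p, hp⟩ : ∃ p, p = ⁅a, x⁆ := ⟨_, rfl⟩
  rw [← hp] at s1 hcube PPP hpI ⊢
  have hPt : ∀ t, φ p * (φ p * (φ p * t)) = 0 := fun t => by
    rw [← mul_assoc, ← mul_assoc, PPP, zero_mul]
  have hP0 : φ p * (φ p * φ p) = 0 := by rw [← mul_assoc, PPP]
  -- linearize: `P² Z P = 0`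
  have s2 : ∀ z ∈ I, φ p * (φ p * (φ z * φ p)) = 0 := fun z hz => by
    refine h2 _ ?_
    ext ⟨y, hy⟩
    have e := s1 (z + y) (add_mem hz hy)
    have e1 := s1 z hz
    have e2 := s1 y hy
    have e3 := hcube _ (meml z y hz)
    have e4 : ⁅y, ⁅p, z⁆⁆ = ⁅z, ⁅p, y⁆⁆ - ⁅p, ⁅z, y⁆⁆ := by
      rw [leibniz_lie p z y, ← lie_skew y ⁅p, z⁆]; abel
    simp only [lie_add, add_lie, e1, e2, e4, lie_sub, e3] at e
    rw [two_mul]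
    simpa [hφa] using e
  have s3 : ∀ z ∈ I, ⁅p, ⁅p, z⁆⁆ = 0 := fun z hz => by
    refine nd _ (memr _ _ (memr _ _ hz)) ?_
    have hj := (aux_jordan h3 (φ p) (φ z) PPP
      (by simpa only [LieHom.map_lie, map_zero] using congrArg φ (hcube z hz))).2
    simp only [LieHom.map_lie]
    rw [hj]
    have e := s2 z hz
    have et : ∀ t, φ p * (φ p * (φ z * (φ p * t))) = 0 := fun t => by
      have := congrArg (· * t) e; simpa [mul_assoc] using this
    have e2 := s2 ⁅z, ⁅p, z⁆⁆ (meml _ _ hz)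
    simp only [LieHom.map_lie, Ring.lie_def, mul_sub, sub_mul, mul_assoc, hPt, hP0, e, et,
      mul_zero] at e2
    simpa using e2
  exact hI p hpI s3
end
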